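/- Assume DᵀD ≻ 0. Then for every symmetric U ⪰ 0 one has Λ(U) ≻ 0 (hence invertible) and Ric^α(U) ⪰ 0; moreover Ric^α is monotone on the positive semidefinite cone: if 0 ⪯ U ⪯ V then Ric^α(U) ⪯ Ric^α(V). -/

import Mathlib

open Matrix

noncomputable section

/-- `Z_x(U) = Diag(σ̄ₓᵀ U σ̄ₓ)`. -/
def Zx {n : ℕ} (σbx U : Matrix (Fin n) (Fin n) ℝ) : Matrix (Fin n) (Fin n) ℝ :=
  Matrix.diagonal (fun i => (σbxᵀ * U * σbx) i i)

/-- `Z_u(U) = Diag(σ̄ᵤᵀ U σ̄ᵤ)`. -/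
def Zu {n m : ℕ} (σbu : Matrix (Fin n) (Fin m) ℝ) (U : Matrix (Fin n) (Fin n) ℝ) :
    Matrix (Fin m) (Fin m) ℝ :=
  Matrix.diagonal (fun i => (σbuᵀ * U * σbu) i i)

/-- `L^α(U) = α (Aᵀ U A + Z_x(U))`. -/
def Lop {n : ℕ} (α : ℝ) (A σbx U : Matrix (Fin n) (Fin n) ℝ) : Matrix (Fin n) (Fin n) ℝ :=
  α • (Aᵀ * U * A + Zx σbx U)

/-- `Σ(U) = Bᵀ U A + α⁻¹ Dᵀ C`. -/
def Sig {n m p : ℕ} (α : ℝ) (A : Matrix (Fin n) (Fin n) ℝ) (B : Matrix (Fin n) (Fin m) ℝ)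
    (C : Matrix (Fin p) (Fin n) ℝ) (D : Matrix (Fin p) (Fin m) ℝ)
    (U : Matrix (Fin n) (Fin n) ℝ) : Matrix (Fin m) (Fin n) ℝ :=
  Bᵀ * U * A + α⁻¹ • (Dᵀ * C)

/-- `Λ(U) = Bᵀ U B + Z_u(U) + α⁻¹ Dᵀ D`. -/
def Lam {n m p : ℕ} (α : ℝ) (B σbu : Matrix (Fin n) (Fin m) ℝ) (D : Matrix (Fin p) (Fin m) ℝ)
    (U : Matrix (Fin n) (Fin n) ℝ) : Matrix (Fin m) (Fin m) ℝ :=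
  Bᵀ * U * B + Zu σbu U + α⁻¹ • (Dᵀ * D)

/-- `Ric^α(U) = L^α(U) − α Σ(U)ᵀ Λ(U)⁻¹ Σ(U) + Cᵀ C`. -/
def Ric {n m p : ℕ} (α : ℝ) (A σbx : Matrix (Fin n) (Fin n) ℝ) (B σbu : Matrix (Fin n) (Fin m) ℝ)
    (C : Matrix (Fin p) (Fin n) ℝ) (D : Matrix (Fin p) (Fin m) ℝ)
    (U : Matrix (Fin n) (Fin n) ℝ) : Matrix (Fin n) (Fin n) ℝ :=
  Lop α A σbx U - α • ((Sig α A B C D U)ᵀ * (Lam α B σbu D U)⁻¹ * Sig α A B C D U) + Cᵀ * C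

/-- `H^α_G(U) = L^α(U) + Cᵀ C + α (Gᵀ Λ(U) G + Σ(U)ᵀ G + Gᵀ Σ(U))`. -/
def HG {n m p : ℕ} (α : ℝ) (A σbx : Matrix (Fin n) (Fin n) ℝ) (B σbu : Matrix (Fin n) (Fin m) ℝ)
    (C : Matrix (Fin p) (Fin n) ℝ) (D : Matrix (Fin p) (Fin m) ℝ)
    (G : Matrix (Fin m) (Fin n) ℝ) (U : Matrix (Fin n) (Fin n) ℝ) : Matrix (Fin n) (Fin n) ℝ :=
  Lop α A σbx U + Cᵀ * C +
    α • (Gᵀ * Lam α B σbu D U * G + (Sig α A B C D U)ᵀ * G + Gᵀ * Sig α A B C D U)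

end

section

variable {n m p : ℕ}

theorem Zx_posSemidef (σbx : Matrix (Fin n) (Fin n) ℝ) {U : Matrix (Fin n) (Fin n) ℝ}
    (hU : U.PosSemidef) : (Zx σbx U).PosSemidef :=
  .diagonal fun _ => (hU.conjTranspose_mul_mul_same σbx).diag_nonneg

theorem Zu_posSemidef (σbu : Matrix (Fin n) (Fin m) ℝ) {U : Matrix (Fin n) (Fin n) ℝ}
    (hU : U.PosSemidef) : (Zu σbu U).PosSemidef :=
  .diagonal fun _ => (hU.conjTranspose_mul_mul_same σbu).diag_nonneg

theorem Zx_sub (σbx U V : Matrix (Fin n) (Fin n) ℝ) : Zx σbx (V - U) = Zx σbx V - Zx σbx U := by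
  simp [Zx, Matrix.mul_sub, Matrix.sub_mul]

theorem Zu_sub (σbu : Matrix (Fin n) (Fin m) ℝ) (U V : Matrix (Fin n) (Fin n) ℝ) :
    Zu σbu (V - U) = Zu σbu V - Zu σbu U := by
  simp [Zu, Matrix.mul_sub, Matrix.sub_mul]

theorem Lam_posDef {α : ℝ} (hα : 0 < α) (B σbu : Matrix (Fin n) (Fin m) ℝ)
    {D : Matrix (Fin p) (Fin m) ℝ} (hD : (Dᵀ * D).PosDef) {U : Matrix (Fin n) (Fin n) ℝ}
    (hU : U.PosSemidef) : (Lam α B σbu D U).PosDef :=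
  .posSemidef_add ((hU.conjTranspose_mul_mul_same B).add (Zu_posSemidef σbu hU))
    (hD.smul (inv_pos.2 hα))

/-- The part of `HG` that is linear in `U`, in closed-loop form. -/
def closedLoop (α : ℝ) (A σbx : Matrix (Fin n) (Fin n) ℝ) (B σbu : Matrix (Fin n) (Fin m) ℝ)
    (G : Matrix (Fin m) (Fin n) ℝ) (U : Matrix (Fin n) (Fin n) ℝ) : Matrix (Fin n) (Fin n) ℝ :=
  α • ((A + B * G)ᵀ * U * (A + B * G) + Zx σbx U + Gᵀ * Zu σbu U * G)

theorem closedLoop_posSemidef {α : ℝ} (hα : 0 < α) (A σbx : Matrix (Fin n) (Fin n) ℝ)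
    (B σbu : Matrix (Fin n) (Fin m) ℝ) (G : Matrix (Fin m) (Fin n) ℝ)
    {U : Matrix (Fin n) (Fin n) ℝ} (hU : U.PosSemidef) :
    (closedLoop α A σbx B σbu G U).PosSemidef :=
  (((hU.conjTranspose_mul_mul_same (A + B * G)).add (Zx_posSemidef σbx hU)).add
    ((Zu_posSemidef σbu hU).conjTranspose_mul_mul_same G)).smul hα.le

theorem closedLoop_sub (α : ℝ) (A σbx : Matrix (Fin n) (Fin n) ℝ)
    (B σbu : Matrix (Fin n) (Fin m) ℝ) (G : Matrix (Fin m) (Fin n) ℝ)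
    (U V : Matrix (Fin n) (Fin n) ℝ) :
    closedLoop α A σbx B σbu G (V - U) =
      closedLoop α A σbx B σbu G V - closedLoop α A σbx B σbu G U := by
  simp only [closedLoop, Zx_sub, Zu_sub, Matrix.mul_sub, Matrix.sub_mul]
  module

theorem HG_eq_closedLoop_add {α : ℝ} (hα : α ≠ 0) (A σbx : Matrix (Fin n) (Fin n) ℝ)
    (B σbu : Matrix (Fin n) (Fin m) ℝ) (C : Matrix (Fin p) (Fin n) ℝ)
    (D : Matrix (Fin p) (Fin m) ℝ) (G : Matrix (Fin m) (Fin n) ℝ)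
    {U : Matrix (Fin n) (Fin n) ℝ} (hU : U.IsHermitian) :
    HG α A σbx B σbu C D G U =
      closedLoop α A σbx B σbu G U + (C + D * G)ᵀ * (C + D * G) := by
  have hT : Uᵀ = U := hU
  simp only [HG, closedLoop, Lop, Lam, Sig, Matrix.transpose_add, Matrix.transpose_mul,
    Matrix.transpose_smul, Matrix.transpose_transpose, hT, Matrix.mul_add, Matrix.add_mul,
    Matrix.mul_assoc, Matrix.smul_mul, Matrix.mul_smul, smul_add, smul_inv_smul₀ hα]
  abel

/-- Completion of the square in the gain `G`. -/
theorem HG_eq_Ric_add (α : ℝ) (A σbx : Matrix (Fin n) (Fin n) ℝ)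
    (B σbu : Matrix (Fin n) (Fin m) ℝ) (C : Matrix (Fin p) (Fin n) ℝ)
    (D : Matrix (Fin p) (Fin m) ℝ) (G : Matrix (Fin m) (Fin n) ℝ)
    {U : Matrix (Fin n) (Fin n) ℝ} (hΛ : (Lam α B σbu D U).PosDef) :
    HG α A σbx B σbu C D G U = Ric α A σbx B σbu C D U +
      α • ((G + (Lam α B σbu D U)⁻¹ * Sig α A B C D U)ᵀ * Lam α B σbu D U *
        (G + (Lam α B σbu D U)⁻¹ * Sig α A B C D U)) := by
  have hdet := (Matrix.isUnit_iff_isUnit_det _).1 hΛ.isUnit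
  have hT : (Lam α B σbu D U)ᵀ = Lam α B σbu D U := hΛ.isHermitian
  simp only [HG, Ric]
  generalize Lam α B σbu D U = Λ at hdet hT ⊢
  generalize Sig α A B C D U = S
  simp only [Matrix.transpose_add, Matrix.transpose_mul, Matrix.transpose_nonsing_inv, hT,
    Matrix.mul_add, Matrix.add_mul, Matrix.mul_assoc, smul_add,
    Matrix.mul_nonsing_inv_cancel_left _ _ hdet, Matrix.nonsing_inv_mul_cancel_left _ _ hdet]
  abel

theorem Ric_eq_HG (α : ℝ) (A σbx : Matrix (Fin n) (Fin n) ℝ)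
    (B σbu : Matrix (Fin n) (Fin m) ℝ) (C : Matrix (Fin p) (Fin n) ℝ)
    (D : Matrix (Fin p) (Fin m) ℝ) {U : Matrix (Fin n) (Fin n) ℝ}
    (hΛ : (Lam α B σbu D U).PosDef) :
    Ric α A σbx B σbu C D U =
      HG α A σbx B σbu C D (-((Lam α B σbu D U)⁻¹ * Sig α A B C D U)) U := by
  simp [HG_eq_Ric_add α A σbx B σbu C D _ hΛ]

end

/-- If `DᵀD ≻ 0` then for every `U ⪰ 0` one has `Λ(U) ≻ 0` (hence
invertible) and `Ric^α(U) ⪰ 0`; moreover `Ric^α` is monotone on the PSD cone. -/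
theorem stmt17 {n m p : ℕ} (α : ℝ) (hα : 0 < α) (A σbx : Matrix (Fin n) (Fin n) ℝ)
    (B σbu : Matrix (Fin n) (Fin m) ℝ) (C : Matrix (Fin p) (Fin n) ℝ)
    (D : Matrix (Fin p) (Fin m) ℝ) (hD : (Dᵀ * D).PosDef) :
    (∀ U : Matrix (Fin n) (Fin n) ℝ, U.PosSemidef →
      (Lam α B σbu D U).PosDef ∧ IsUnit (Lam α B σbu D U).det ∧
        (Ric α A σbx B σbu C D U).PosSemidef) ∧
    ∀ U V : Matrix (Fin n) (Fin n) ℝ, U.PosSemidef → (V - U).PosSemidef →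
      (Ric α A σbx B σbu C D V - Ric α A σbx B σbu C D U).PosSemidef := by
  refine ⟨fun U hU => ?_, fun U V hU hVU => ?_⟩
  · have hΛ := Lam_posDef hα B σbu hD hU
    refine ⟨hΛ, (Matrix.isUnit_iff_isUnit_det _).1 hΛ.isUnit, ?_⟩
    rw [Ric_eq_HG α A σbx B σbu C D hΛ,
      HG_eq_closedLoop_add hα.ne' A σbx B σbu C D _ hU.isHermitian]
    exact (closedLoop_posSemidef hα A σbx B σbu _ hU).add (posSemidef_conjTranspose_mul_self _)
  · have hV : V.PosSemidef := by simpa using hU.add hVU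
    have hΛ := Lam_posDef hα B σbu hD hU
    rw [Ric_eq_HG α A σbx B σbu C D (Lam_posDef hα B σbu hD hV)]
    set G := -((Lam α B σbu D V)⁻¹ * Sig α A B C D V)
    have key : HG α A σbx B σbu C D G V - Ric α A σbx B σbu C D U =
        closedLoop α A σbx B σbu G (V - U) +
          α • ((G + (Lam α B σbu D U)⁻¹ * Sig α A B C D U)ᵀ * Lam α B σbu D U *
            (G + (Lam α B σbu D U)⁻¹ * Sig α A B C D U)) := by
      have hsq := HG_eq_Ric_add α A σbx B σbu C D G hΛ
      rw [HG_eq_closedLoop_add hα.ne' A σbx B σbu C D _ hU.isHermitian] at hsq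
      rw [HG_eq_closedLoop_add hα.ne' A σbx B σbu C D _ hV.isHermitian, closedLoop_sub,
        sub_eq_iff_eq_add, add_assoc, add_comm (α • _), ← hsq]
      abel
    rw [key]
    exact (closedLoop_posSemidef hα A σbx B σbu G hVU).add
      ((hΛ.posSemidef.conjTranspose_mul_mul_same _).smul hα.le)
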